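/- arXiv:2006.16995 — 2 statements merged into one kernel-verified Lean document; each statement's English description precedes it below -/
import Mathlib

section
/- In the universal (free) Coxeter system on an index type B with decidable equality, for every word L : List B the Demazure product equals the product of the simple reflections along the destuttered word: δ(L) = π(L.destutter). -/
/-- The universal (free) Coxeter matrix on an index type `B`: its diagonal entries are `1`
and its off-diagonal entries are `0` (encoding order `∞`). -/
def universalCoxeterMatrix (B : Type*) [DecidableEq B] : CoxeterMatrix B where
  M := Matrix.of fun b b' => if b = b' then 1 else 0
  isSymm := by
    ext b b'
    by_cases h : b = b' <;> simp [Matrix.transpose_apply, h, eq_comm]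
  diagonal := fun b => by simp
  off_diagonal := fun b b' h => by simp [h]

/-- The Demazure product of a word in a Coxeter system: the left fold starting from the
identity in which the step sends `(w, b)` to `w * s b` if this increases the Coxeter
length, and to `w` otherwise. -/
noncomputable def demazureProd {B W : Type*} [Group W] {M : CoxeterMatrix B}
    (cs : CoxeterSystem M W) (L : List B) : W :=
  L.foldl (fun w b =>
    if cs.length w < cs.length (w * cs.simple b) then w * cs.simple b else w) 1

/-- Delete the first letter of a word if it is `b`, and prepend `b` otherwise. -/
def toggleHead {B : Type*} [DecidableEq B] (b : B) : List B → List B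
  | [] => [b]
  | a :: l => if b = a then l else b :: a :: l

theorem isChain_toggleHead {B : Type*} [DecidableEq B] (b : B) {l : List B}
    (hl : l.IsChain (· ≠ ·)) : (toggleHead b l).IsChain (· ≠ ·) := by
  cases l with
  | nil => simp [toggleHead]
  | cons a l =>
    by_cases h : b = a
    · simpa [toggleHead, h] using hl.tail
    · simpa [toggleHead, h] using hl

theorem toggleHead_toggleHead {B : Type*} [DecidableEq B] (b : B) {l : List B}
    (hl : l.IsChain (· ≠ ·)) : toggleHead b (toggleHead b l) = l := by
  rcases l with _ | ⟨a, _ | ⟨c, l⟩⟩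
  · simp [toggleHead]
  · by_cases h : b = a <;> simp [toggleHead, h]
  · by_cases h : b = a
    · subst h
      have hbc : b ≠ c := (List.isChain_cons_cons.mp hl).1
      simp [toggleHead, hbc]
    · simp [toggleHead, h]

theorem toggleHead_of_isChain_cons {B : Type*} [DecidableEq B] {b : B} {l : List B}
    (hl : (b :: l).IsChain (· ≠ ·)) : toggleHead b l = b :: l := by
  cases l with
  | nil => rfl
  | cons a l => simp [toggleHead, (List.isChain_cons_cons.mp hl).1]

theorem length_toggleHead_le {B : Type*} [DecidableEq B] (b : B) (l : List B) :
    (toggleHead b l).length ≤ l.length + 1 := by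
  cases l with
  | nil => simp [toggleHead]
  | cons a l =>
    by_cases h : b = a
    · simp [toggleHead, h]
      omega
    · simp [toggleHead, h]

/-- `toggleHead b` as a self-map of the words without equal adjacent letters. -/
def toggleHeadEnd {B : Type*} [DecidableEq B] (b : B) :
    Function.End {l : List B // l.IsChain (· ≠ ·)} :=
  fun l => ⟨toggleHead b l.1, isChain_toggleHead b l.2⟩

theorem isLiftable_toggleHeadEnd {B : Type*} [DecidableEq B] :
    (universalCoxeterMatrix B).IsLiftable (toggleHeadEnd (B := B)) := by
  intro b b'
  by_cases h : b = b'
  · subst h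
    rw [(universalCoxeterMatrix B).diagonal, pow_one]
    funext l
    exact Subtype.ext (toggleHead_toggleHead b l.2)
  · have h0 : (universalCoxeterMatrix B).M b b' = 0 := by simp [universalCoxeterMatrix, h]
    rw [h0, pow_zero]

/-- The action of the universal Coxeter group on the words without equal adjacent letters. -/
noncomputable def universalAction {B W : Type*} [DecidableEq B] [Group W]
    (cs : CoxeterSystem (universalCoxeterMatrix B) W) :
    W →* Function.End {l : List B // l.IsChain (· ≠ ·)} :=
  cs.lift ⟨toggleHeadEnd, isLiftable_toggleHeadEnd⟩

theorem universalAction_wordProd {B W : Type*} [DecidableEq B] [Group W]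
    (cs : CoxeterSystem (universalCoxeterMatrix B) W) (ω : List B) :
    (universalAction cs (cs.wordProd ω) ⟨[], List.isChain_nil⟩).1 =
      ω.foldr toggleHead [] := by
  induction ω with
  | nil => rw [cs.wordProd_nil, map_one]; rfl
  | cons b ω ih =>
    rw [cs.wordProd_cons, map_mul, List.foldr_cons, ← ih, universalAction,
      cs.lift_apply_simple isLiftable_toggleHeadEnd]
    rfl

theorem length_foldr_toggleHead_le {B : Type*} [DecidableEq B] (ω : List B) :
    (ω.foldr toggleHead []).length ≤ ω.length := by
  induction ω with
  | nil => simp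
  | cons b ω ih =>
    exact (length_toggleHead_le b _).trans (Nat.succ_le_succ ih)

theorem foldr_toggleHead_of_isChain {B : Type*} [DecidableEq B] {ω : List B}
    (hω : ω.IsChain (· ≠ ·)) : ω.foldr toggleHead [] = ω := by
  induction ω with
  | nil => rfl
  | cons b ω ih => rw [List.foldr_cons, ih hω.tail, toggleHead_of_isChain_cons hω]

/-- In the universal Coxeter system, words without equal adjacent letters are reduced. -/
theorem universal_isReduced_of_isChain {B W : Type*} [DecidableEq B] [Group W]
    (cs : CoxeterSystem (universalCoxeterMatrix B) W) {ω : List B}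
    (hω : ω.IsChain (· ≠ ·)) : cs.IsReduced ω := by
  refine le_antisymm (cs.length_wordProd_le ω) ?_
  obtain ⟨ω', hred, hprod⟩ := cs.exists_isReduced (cs.wordProd ω)
  have h := universalAction_wordProd cs ω
  rw [foldr_toggleHead_of_isChain hω, hprod, universalAction_wordProd] at h
  rw [hprod, hred.eq, ← h]
  exact length_foldr_toggleHead_le ω'

theorem foldl_demazure_step_eq_wordProd_append_destutter' {B W : Type*} [DecidableEq B]
    [Group W] (cs : CoxeterSystem (universalCoxeterMatrix B) W) (L ω : List B) (a : B)
    (hω : (ω ++ [a]).IsChain (· ≠ ·)) :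
    L.foldl (fun w b =>
      if cs.length w < cs.length (w * cs.simple b) then w * cs.simple b else w)
      (cs.wordProd (ω ++ [a])) = cs.wordProd (ω ++ L.destutter' (· ≠ ·) a) := by
  induction L generalizing ω a with
  | nil => rfl
  | cons b L ih =>
    have hmul : cs.wordProd (ω ++ [a]) * cs.simple b = cs.wordProd (ω ++ [a] ++ [b]) := by
      rw [cs.wordProd_append (ω ++ [a]), cs.wordProd_singleton]
    have hlen := (universal_isReduced_of_isChain cs hω).eq
    rw [List.foldl_cons]
    by_cases h : a = b
    · subst h
      have hle : cs.length (cs.wordProd (ω ++ [a]) * cs.simple a) ≤ ω.length := by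
        rw [cs.wordProd_append, cs.wordProd_singleton, cs.simple_mul_simple_cancel_right]
        exact cs.length_wordProd_le ω
      rw [if_neg (by rw [hlen, List.length_append]; omega), ih ω a hω,
        List.destutter'_cons_neg _ (by simp)]
    · have hchain : (ω ++ [a] ++ [b]).IsChain (· ≠ ·) :=
        hω.append (List.isChain_singleton b) (by simpa using h)
      have hlen' := (universal_isReduced_of_isChain cs hchain).eq
      rw [hmul, if_pos (by rw [hlen, hlen']; simp), ih _ b hchain,
        List.destutter'_cons_pos _ h, List.append_assoc, List.singleton_append]

/-- In the universal (free) Coxeter system on `B`, for every word `L` the Demazure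
product equals the product of the simple reflections along the destuttered word:
`δ(L) = π(L.destutter)`. -/
theorem universal_demazureProd_eq_wordProd_destutter {B W : Type*} [DecidableEq B]
    [Group W] (cs : CoxeterSystem (universalCoxeterMatrix B) W) (L : List B) :
    demazureProd cs L = cs.wordProd (L.destutter (· ≠ ·)) := by
  cases L with
  | nil => simp [demazureProd]
  | cons a L =>
    have h := foldl_demazure_step_eq_wordProd_append_destutter' cs L [] a
      (List.isChain_singleton a)
    simpa [demazureProd, List.destutter_cons'] using h
end

section
/- For every n ≥ 2 and every permutation w ∈ S_n, the sum over all quasi-Yamanouchi pipe dreams D of size n with shape w (i.e., with Demazure product δ(word(D)) = w) of (−1)^(|D| − ℓ(w)) equals 1. Equivalently, writing QPD_k(w) for the set of quasi-Yamanouchi pipe dreams of shape w with excess k, one has Σ_k (−1)^k |QPD_k(w)| = 1. -/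
open scoped Classical

/-- `D` is a pipe dream of size `n`: a finite set of pairs `(i, j)` of positive integers
with `i + j ≤ n`. -/
def IsPipeDream (n : ℕ) (D : Finset (ℕ × ℕ)) : Prop :=
  ∀ c ∈ D, 1 ≤ c.1 ∧ 1 ≤ c.2 ∧ c.1 + c.2 ≤ n

/-- The word of a pipe dream `D` of size `n`: reading the rows `i = 1, 2, …` from top to
bottom and each row from right to left (`j` decreasing), recording the letter `i + j - 1`
for each cross `(i, j) ∈ D`. -/
def pdWord (n : ℕ) (D : Finset (ℕ × ℕ)) : List ℕ :=
  ((List.range n).map (· + 1)).flatMap (fun i =>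
    ((((List.range n).map (· + 1)).reverse.filter (fun j => (i, j) ∈ D)).map
      (fun j => i + j - 1)))

/-- The simple transposition `s k = (k, k+1)` (1-based) in the symmetric group on
`{1, …, n}`, realized as a permutation of `Fin n`; equals the identity if `k` is out of
range. -/
def simpleT (n k : ℕ) : Equiv.Perm (Fin n) :=
  if h : 0 < k ∧ k < n then
    Equiv.swap ⟨k - 1, lt_of_le_of_lt (Nat.sub_le k 1) h.2⟩ ⟨k, h.2⟩
  else 1

/-- The number of inversions of a permutation of `Fin n` (the Coxeter length in `S_n`). -/
def invCount (n : ℕ) (w : Equiv.Perm (Fin n)) : ℕ :=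
  (Finset.univ.filter (fun p : Fin n × Fin n => p.1 < p.2 ∧ w p.2 < w p.1)).card

/-- The product of the simple transpositions along a word. -/
def pdProd (n : ℕ) (L : List ℕ) : Equiv.Perm (Fin n) :=
  (L.map (simpleT n)).prod

/-- The Demazure product of a word: the left fold starting from the identity whose step
sends `(w, k)` to `w * s k` if this increases the number of inversions, and to `w`
otherwise. -/
def pdDemazure (n : ℕ) (L : List ℕ) : Equiv.Perm (Fin n) :=
  L.foldl (fun w k =>
    if invCount n w < invCount n (w * simpleT n k) then w * simpleT n k else w) 1

/-- All possible cells of a pipe dream of size `n`. -/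
def allCells (n : ℕ) : Finset (ℕ × ℕ) :=
  (Finset.range (n + 1) ×ˢ Finset.range (n + 1)).filter
    (fun c => 1 ≤ c.1 ∧ 1 ≤ c.2 ∧ c.1 + c.2 ≤ n)

/-- The pipe dream `D` admits a slide move in row `i` at its leftmost cross `(i, j)`:
`j ≥ 2`, `(i, j)` is the leftmost cross of row `i`, and every cross `(i+1, j')` of row
`i + 1` satisfies `j' < j`. -/
def AdmitsSlideAt (D : Finset (ℕ × ℕ)) (i j : ℕ) : Prop :=
  (i, j) ∈ D ∧ 2 ≤ j ∧ (∀ j', (i, j') ∈ D → j ≤ j') ∧ (∀ j', (i + 1, j') ∈ D → j' < j)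

/-- `D'` is obtained from `D` by a slide move: some leftmost cross `(i, j)` admitting a
slide move is moved southwest to `(i+1, j-1)`. -/
def SlideMove (D D' : Finset (ℕ × ℕ)) : Prop :=
  ∃ i j, AdmitsSlideAt D i j ∧ D' = insert (i + 1, j - 1) (D.erase (i, j))

/-- `D` is quasi-Yamanouchi: it admits no slide move. -/
def QuasiYamanouchi (D : Finset (ℕ × ℕ)) : Prop :=
  ∀ i j, ¬ AdmitsSlideAt D i j


/-! ### Inversions and simple transpositions -/

lemma simpleT_mul_self (n k : ℕ) : simpleT n k * simpleT n k = 1 := by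
  unfold simpleT
  split_ifs <;> simp

lemma mul_simpleT_cancel (n k : ℕ) (w : Equiv.Perm (Fin n)) :
    w * simpleT n k * simpleT n k = w := by
  rw [mul_assoc, simpleT_mul_self, mul_one]

lemma simpleT_eq_swap {n : ℕ} {a b : Fin n} (hab : a.1 + 1 = b.1) :
    simpleT n b = Equiv.swap a b := by
  have h : 0 < b.1 ∧ b.1 < n := ⟨by omega, b.2⟩
  have ha : a = ⟨b.1 - 1, lt_of_le_of_lt (Nat.sub_le _ 1) h.2⟩ := Fin.ext (by simp; omega)
  rw [simpleT, dif_pos h, ha]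

lemma simpleT_eq_one {n k : ℕ} (h : ¬ (0 < k ∧ k < n)) : simpleT n k = 1 :=
  dif_neg h

lemma invCount_one (n : ℕ) : invCount n 1 = 0 := by
  unfold invCount
  simp only [Finset.card_eq_zero, Finset.filter_eq_empty_iff]
  rintro p - ⟨h1, h2⟩
  exact absurd h1 (not_lt.mpr h2.le)

lemma invCount_mul_swap_of_lt {n : ℕ} {a b : Fin n} (hab : a.1 + 1 = b.1)
    (w : Equiv.Perm (Fin n)) (h : w a < w b) :
    invCount n (w * Equiv.swap a b) = invCount n w + 1 := by
  set s := Equiv.swap a b with hs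
  have hba : b ≠ a := fun e => by rw [e] at hab; omega
  have key : (Finset.univ.filter
      (fun p : Fin n × Fin n => p.1 < p.2 ∧ (w * s) p.2 < (w * s) p.1)) =
      insert (a, b) ((Finset.univ.filter
        (fun p : Fin n × Fin n => p.1 < p.2 ∧ w p.2 < w p.1)).map
        (Equiv.prodCongr s s).toEmbedding) := by
    ext ⟨x, y⟩
    have hsymm : s.symm = s := Equiv.symm_swap a b
    rw [Finset.mem_filter, Finset.mem_insert, Finset.mem_map_equiv, Finset.mem_filter]
    simp only [Finset.mem_univ, true_and, Prod.mk.injEq, Equiv.Perm.mul_apply, Equiv.prodCongr_symm,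
      Equiv.prodCongr_apply, Prod.map_apply, hsymm]
    by_cases hxa : x = a
    · subst hxa
      have hsx : s x = b := Equiv.swap_apply_left _ _
      by_cases hyb : y = b
      · subst hyb
        have hsy : s y = x := Equiv.swap_apply_right _ _
        rw [hsx, hsy]
        simp only [and_self, true_or, iff_true]
        exact ⟨by rw [Fin.lt_def]; omega, h⟩
      · by_cases hyx : y = x
        · subst hyx; simp [Ne.symm hba]
        · have hsy : s y = y := Equiv.swap_apply_of_ne_of_ne hyx hyb
          rw [hsx, hsy]
          simp only [hyb, and_false, false_or, Fin.lt_def]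
          have : y.1 ≠ b.1 := fun e => hyb (Fin.ext e)
          constructor <;> rintro ⟨h1, h2⟩ <;> exact ⟨by omega, h2⟩
    · by_cases hxb : x = b
      · subst hxb
        have hsx : s x = a := Equiv.swap_apply_right _ _
        by_cases hyb : y = x
        · subst hyb; simp [hxa]
        · by_cases hya : y = a
          · subst hya
            have hsy : s y = x := Equiv.swap_apply_left _ _
            rw [hsx, hsy]
            simp only [hba, false_and, false_or, Fin.lt_def] at h ⊢
            omega
          · have hsy : s y = y := Equiv.swap_apply_of_ne_of_ne hya hyb
            rw [hsx, hsy]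
            simp only [hxa, false_and, false_or, Fin.lt_def]
            have : y.1 ≠ x.1 := fun e => hyb (Fin.ext e)
            constructor <;> rintro ⟨h1, h2⟩ <;> exact ⟨by omega, h2⟩
      · have hsx : s x = x := Equiv.swap_apply_of_ne_of_ne hxa hxb
        rw [hsx]
        simp only [hxa, false_and, false_or]
        have hx1 : x.1 ≠ a.1 := fun e => hxa (Fin.ext e)
        have hx2 : x.1 ≠ b.1 := fun e => hxb (Fin.ext e)
        by_cases hya : y = a
        · subst hya
          rw [show s y = b from Equiv.swap_apply_left _ _]
          simp only [Fin.lt_def]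
          constructor <;> rintro ⟨h1, h2⟩ <;> exact ⟨by omega, h2⟩
        · by_cases hyb : y = b
          · subst hyb
            rw [show s y = a from Equiv.swap_apply_right _ _]
            simp only [Fin.lt_def]
            constructor <;> rintro ⟨h1, h2⟩ <;> exact ⟨by omega, h2⟩
          · rw [show s y = y from Equiv.swap_apply_of_ne_of_ne hya hyb]
  unfold invCount
  rw [key, Finset.card_insert_of_notMem, Finset.card_map]
  simp only [Finset.mem_map_equiv, Finset.mem_filter, Finset.mem_univ, true_and, not_and,
    Equiv.prodCongr_symm, Equiv.prodCongr_apply, Prod.map_apply, hs, Equiv.symm_swap,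
    Equiv.swap_apply_left, Equiv.swap_apply_right, Fin.lt_def]
  omega

lemma invCount_mul_swap_of_gt {n : ℕ} {a b : Fin n} (hab : a.1 + 1 = b.1)
    (w : Equiv.Perm (Fin n)) (h : w b < w a) :
    invCount n w = invCount n (w * Equiv.swap a b) + 1 := by
  have := invCount_mul_swap_of_lt hab (w * Equiv.swap a b) (by simpa using h)
  rwa [mul_assoc, Equiv.swap_mul_self, mul_one] at this

lemma invCount_mul_swap_lt_iff {n : ℕ} {a b : Fin n} (hab : a.1 + 1 = b.1)
    (w : Equiv.Perm (Fin n)) :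
    invCount n (w * Equiv.swap a b) < invCount n w ↔ w b < w a := by
  rcases lt_trichotomy (w a) (w b) with h | h | h
  · have := invCount_mul_swap_of_lt hab w h
    exact ⟨fun _ => by omega, fun h' => absurd h' h.not_gt⟩
  · rw [w.injective h] at hab
    omega
  · have := invCount_mul_swap_of_gt hab w h
    exact ⟨fun _ => h, fun _ => by omega⟩

/-- Multiplying by a genuine simple transposition changes the length by exactly one. -/
lemma invCount_mul_simpleT {n k : ℕ} (hk : 0 < k ∧ k < n) (w : Equiv.Perm (Fin n)) :
    invCount n (w * simpleT n k) = invCount n w + 1 ∨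
      invCount n w = invCount n (w * simpleT n k) + 1 := by
  have hab : (⟨k - 1, by omega⟩ : Fin n).1 + 1 = (⟨k, hk.2⟩ : Fin n).1 := by
    simp only; omega
  have hs := simpleT_eq_swap hab
  simp only at hs
  rw [hs]
  rcases lt_trichotomy (w ⟨k - 1, by omega⟩) (w ⟨k, hk.2⟩) with h | h | h
  · exact Or.inl (invCount_mul_swap_of_lt hab w h)
  · have := congrArg Fin.val (w.injective h)
    simp only at this
    omega
  · exact Or.inr (invCount_mul_swap_of_gt hab w h)

/-! ### Demazure products -/

/-- One step of the Demazure product. -/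
noncomputable def demazureStep (n : ℕ) (w : Equiv.Perm (Fin n)) (k : ℕ) : Equiv.Perm (Fin n) :=
  if invCount n w < invCount n (w * simpleT n k) then w * simpleT n k else w

/-- The opposite step, multiplying by `s k` exactly when this decreases the length. -/
noncomputable def descentStep (n : ℕ) (k : ℕ) (w : Equiv.Perm (Fin n)) : Equiv.Perm (Fin n) :=
  if invCount n (w * simpleT n k) < invCount n w then w * simpleT n k else w

lemma pdDemazure_eq_foldl (n : ℕ) (L : List ℕ) :
    pdDemazure n L = L.foldl (demazureStep n) 1 := rfl

lemma pdDemazure_concat (n : ℕ) (L : List ℕ) (k : ℕ) :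
    pdDemazure n (L ++ [k]) = demazureStep n (pdDemazure n L) k := by
  simp [pdDemazure_eq_foldl]

lemma demazureStep_idem (n : ℕ) (w : Equiv.Perm (Fin n)) (k : ℕ) :
    demazureStep n (demazureStep n w k) k = demazureStep n w k := by
  by_cases h : invCount n w < invCount n (w * simpleT n k)
  · have h' : ¬ invCount n (w * simpleT n k) < invCount n w := by omega
    simp [demazureStep, h, mul_simpleT_cancel, h']
  · simp [demazureStep, h]

lemma pdDemazure_append_dup (n : ℕ) (A B : List ℕ) (k : ℕ) :
    pdDemazure n (A ++ k :: k :: B) = pdDemazure n (A ++ k :: B) := by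
  simp [pdDemazure_eq_foldl, demazureStep_idem]

lemma invCount_demazureStep_le (n : ℕ) (w : Equiv.Perm (Fin n)) (k : ℕ) :
    invCount n (demazureStep n w k) ≤ invCount n w + 1 := by
  unfold demazureStep
  split_ifs with h
  · by_cases hk : 0 < k ∧ k < n
    · rcases invCount_mul_simpleT hk w with h' | h' <;> omega
    · simp [simpleT_eq_one hk]
  · omega

lemma invCount_pdDemazure_le_length (n : ℕ) (L : List ℕ) :
    invCount n (pdDemazure n L) ≤ L.length := by
  induction L using List.reverseRecOn with
  | nil => simp [pdDemazure, invCount_one]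
  | append_singleton L k ih =>
    rw [pdDemazure_concat, List.length_append, List.length_singleton]
    exact (invCount_demazureStep_le n _ k).trans (by omega)

/-- The fibre of a Demazure step over `w`: empty if `s k` is an ascent of `w`, and
`{w, w * s k}` otherwise. -/
lemma demazureStep_eq_iff {n k : ℕ} (hk : 0 < k ∧ k < n) (v w : Equiv.Perm (Fin n)) :
    demazureStep n v k = w ↔
      invCount n (w * simpleT n k) < invCount n w ∧ (v = w ∨ v = w * simpleT n k) := by
  unfold demazureStep
  constructor
  · split_ifs with h
    · rintro rfl
      rw [mul_simpleT_cancel]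
      exact ⟨h, Or.inr rfl⟩
    · rintro rfl
      have := invCount_mul_simpleT hk v
      exact ⟨by omega, Or.inl rfl⟩
  · rintro ⟨h, rfl | rfl⟩
    · rw [if_neg (by omega)]
    · rw [mul_simpleT_cancel, if_pos h]

/-! ### The alternating sum over all subwords -/

/-- The alternating count of subwords of a word with a given Demazure product. The word is
indexed by a duplicate-free list `C`, with letters given by `f`. -/
theorem sum_subwords_pdDemazure {α : Type*} [DecidableEq α] (n : ℕ) (f : α → ℕ) (C : List α)
    (hC : C.Nodup) (hf : ∀ c ∈ C, 0 < f c ∧ f c < n) (w : Equiv.Perm (Fin n)) :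
    ∑ D ∈ C.toFinset.powerset,
        (if pdDemazure n ((C.filter (· ∈ D)).map f) = w then (-1 : ℤ) ^ D.card else 0) =
      if (C.map f).foldr (descentStep n) w = 1 then (-1 : ℤ) ^ invCount n w else 0 := by
  induction C using List.reverseRecOn generalizing w with
  | nil =>
    by_cases h : w = 1
    · subst h; simp [pdDemazure, invCount_one]
    · simp [pdDemazure, h, Ne.symm h]
  | append_singleton C c ih =>
    have hc : c ∉ C := fun h => by
      simpa using (List.nodup_append.mp hC).2.2 c h
    have hk := hf c (by simp)
    replace ih := ih (List.nodup_append.mp hC).1 (fun d hd => hf d (by simp [hd]))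
    have hset : (C ++ [c]).toFinset = insert c C.toFinset := by
      ext; simp
    have hmem : ∀ D ∈ C.toFinset.powerset, c ∉ D := fun D hD h =>
      hc (by simpa using Finset.mem_powerset.mp hD h)
    rw [hset, Finset.sum_powerset_insert (by simpa using hc)]
    have h1 : ∀ D ∈ C.toFinset.powerset,
        (if pdDemazure n (((C ++ [c]).filter (· ∈ D)).map f) = w
          then (-1 : ℤ) ^ D.card else 0) =
        if pdDemazure n ((C.filter (· ∈ D)).map f) = w then (-1 : ℤ) ^ D.card else 0 := by
      intro D hD
      simp [List.filter_append, hmem D hD]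
    have h2 : ∀ D ∈ C.toFinset.powerset,
        (if pdDemazure n (((C ++ [c]).filter (· ∈ insert c D)).map f) = w
          then (-1 : ℤ) ^ (insert c D).card else 0) =
        if invCount n (w * simpleT n (f c)) < invCount n w then
          -(if pdDemazure n ((C.filter (· ∈ D)).map f) = w then (-1 : ℤ) ^ D.card else 0) -
          (if pdDemazure n ((C.filter (· ∈ D)).map f) = w * simpleT n (f c)
            then (-1 : ℤ) ^ D.card else 0)
        else 0 := by
      intro D hD
      have hfil : C.filter (· ∈ insert c D) = C.filter (· ∈ D) := by
        apply List.filter_congr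
        intro d hd
        have : d ≠ c := fun e => hc (e ▸ hd)
        simp [this]
      have hword : ((C ++ [c]).filter (· ∈ insert c D)).map f =
          (C.filter (· ∈ D)).map f ++ [f c] := by
        rw [List.filter_append, hfil]
        simp
      rw [hword, pdDemazure_concat, Finset.card_insert_of_notMem (hmem D hD)]
      simp only [demazureStep_eq_iff hk]
      by_cases hd : invCount n (w * simpleT n (f c)) < invCount n w
      · have hne : w ≠ w * simpleT n (f c) := fun e => by rw [← e] at hd; omega
        by_cases e1 : pdDemazure n ((C.filter (· ∈ D)).map f) = w
        · simp [hd, e1, hne, pow_succ]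
        · by_cases e2 : pdDemazure n ((C.filter (· ∈ D)).map f) = w * simpleT n (f c)
          · simp [hd, e2, hne.symm, pow_succ]
          · simp [hd, e1, e2]
      · simp [hd]
    rw [Finset.sum_congr rfl h1, Finset.sum_congr rfl h2]
    have hfold : ((C ++ [c]).map f).foldr (descentStep n) w =
        (C.map f).foldr (descentStep n) (descentStep n (f c) w) := by
      simp
    rw [hfold]
    by_cases hd : invCount n (w * simpleT n (f c)) < invCount n w
    · have hinv : invCount n w = invCount n (w * simpleT n (f c)) + 1 := by
        have := invCount_mul_simpleT hk w
        omega
      simp only [hd, if_true, Finset.sum_sub_distrib, Finset.sum_neg_distrib, ih, descentStep]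
      rw [hinv]
      split_ifs <;> simp [pow_succ]
    · simp only [hd, if_false, Finset.sum_const_zero, add_zero, ih, descentStep]

/-! ### The staircase word sorts every permutation -/

lemma descentStep_of_invalid {n k : ℕ} (h : ¬ (0 < k ∧ k < n)) (w : Equiv.Perm (Fin n)) :
    descentStep n k w = w := by
  simp [descentStep, simpleT_eq_one h]

lemma foldr_descentStep_filter (n : ℕ) (L : List ℕ) (w : Equiv.Perm (Fin n)) :
    (L.filter (fun k => 0 < k ∧ k < n)).foldr (descentStep n) w =
      L.foldr (descentStep n) w := by
  induction L with
  | nil => rfl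
  | cons k L ih =>
    by_cases h : 0 < k ∧ k < n
    · rw [List.filter_cons_of_pos (by simpa using h), List.foldr_cons, ih, List.foldr_cons]
    · rw [List.filter_cons_of_neg (by simpa using h), ih, List.foldr_cons,
        descentStep_of_invalid h]

/-- `w` is increasing on the positions `≥ i`, except that the entry at position `p` may be
larger than entries to its right. -/
def IncreasingFromExcept {n : ℕ} (i p : ℕ) (w : Equiv.Perm (Fin n)) : Prop :=
  ∀ a b : Fin n, a < b → i ≤ a.1 → a.1 ≠ p → w a < w b

lemma IncreasingFromExcept.descentStep {n i p : ℕ} {w : Equiv.Perm (Fin n)}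
    (h : IncreasingFromExcept i p w) :
    IncreasingFromExcept i (p + 1) (descentStep n (p + 1) w) := by
  by_cases hp : p + 1 < n
  · obtain ⟨x, hx⟩ : ∃ x : Fin n, x.1 = p := ⟨⟨p, by omega⟩, rfl⟩
    obtain ⟨y, hy⟩ : ∃ y : Fin n, y.1 = p + 1 := ⟨⟨p + 1, hp⟩, rfl⟩
    have hxy : x.1 + 1 = y.1 := by omega
    have hs : simpleT n (p + 1) = Equiv.swap x y := by rw [← hy]; exact simpleT_eq_swap hxy
    rw [_root_.descentStep, hs]
    simp only [invCount_mul_swap_lt_iff hxy]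
    intro a b hab hia hap
    have hab' : a.1 < b.1 := hab
    split_ifs with hlt
    · simp only [Equiv.Perm.mul_apply]
      have hay : a ≠ y := fun e => hap (by rw [e, hy])
      by_cases hax : a = x
      · subst hax
        rw [Equiv.swap_apply_left]
        by_cases hby : b = y
        · subst hby; rwa [Equiv.swap_apply_right]
        · rw [Equiv.swap_apply_of_ne_of_ne hab.ne' hby]
          have : b.1 ≠ y.1 := fun e => hby (Fin.ext e)
          exact h y b (by rw [Fin.lt_def]; omega) (by omega) (by omega)
      · rw [Equiv.swap_apply_of_ne_of_ne hax hay]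
        have hax' : a.1 ≠ x.1 := fun e => hax (Fin.ext e)
        refine h a _ ?_ hia (by omega)
        rw [Equiv.swap_apply_def]
        split_ifs with h1 h2
        · subst h1; rw [Fin.lt_def]; omega
        · subst h2; rw [Fin.lt_def]; omega
        · exact hab
    · have hle : w x < w y := lt_of_le_of_ne (not_lt.mp hlt) fun e => by
        rw [w.injective e] at hxy; omega
      by_cases hax : a = x
      · subst hax
        by_cases hby : b = y
        · subst hby; exact hle
        · have : b.1 ≠ y.1 := fun e => hby (Fin.ext e)
          exact hle.trans (h y b (by rw [Fin.lt_def]; omega) (by omega) (by omega))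
      · exact h a b hab hia fun e => hax (Fin.ext (by omega))
  · rw [descentStep_of_invalid (by omega)]
    intro a b hab hia _
    have hab' : a.1 < b.1 := hab
    exact h a b hab hia (by omega)

/-- Reading a row of the full staircase backwards inserts one more entry. -/
lemma IncreasingFromExcept.foldr_row {n i : ℕ} {w : Equiv.Perm (Fin n)}
    (h : IncreasingFromExcept i i w) (m : ℕ) :
    IncreasingFromExcept i (i + m)
      (((List.range m).map (fun t => i + t + 1)).reverse.foldr (_root_.descentStep n) w) := by
  induction m with
  | zero => exact h
  | succ m ih =>
    rw [List.range_succ, List.map_append, List.reverse_append]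
    exact ih.descentStep

lemma foldr_descentStep_staircase (n : ℕ) (w : Equiv.Perm (Fin n)) :
    ((List.range n).flatMap
      (fun i => ((List.range n).map (fun t => i + t + 1)).reverse)).foldr
        (descentStep n) w = 1 := by
  have key : ∀ (m : ℕ) (w : Equiv.Perm (Fin n)), IncreasingFromExcept m n w →
      IncreasingFromExcept 0 n (((List.range m).flatMap
        (fun i => ((List.range n).map (fun t => i + t + 1)).reverse)).foldr
          (descentStep n) w) := by
    intro m
    induction m with
    | zero => exact fun w h => h
    | succ m ih =>
      intro w h
      rw [List.range_succ, List.flatMap_append, List.foldr_append]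
      refine ih _ ?_
      have h' : IncreasingFromExcept m m w := fun a b hab hia ham =>
        h a b hab (by omega) (by omega)
      have := h'.foldr_row n
      rw [List.flatMap_singleton]
      exact fun a b hab hia ham => this a b hab hia (by omega)
  have hmono := key n w (fun a b hab ha _ => by omega)
  set v := ((List.range n).flatMap
      (fun i => ((List.range n).map (fun t => i + t + 1)).reverse)).foldr
        (descentStep n) w
  have hv : StrictMono v := fun a b hab => hmono a b hab (Nat.zero_le _) (by omega)
  have he : hv.orderIsoOfSurjective v v.surjective = OrderIso.refl (Fin n) :=
    Subsingleton.elim _ _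
  ext a
  exact congrArg Fin.val (congrArg (fun e : Fin n ≃o Fin n => e a) he)

/-! ### The alternating sum over all pipe dreams -/

/-- All positions of the `n × n` square in reading order. -/
def squareCells (n : ℕ) : List (ℕ × ℕ) :=
  ((List.range n).map (· + 1)).flatMap (fun i =>
    (((List.range n).map (· + 1)).reverse).map (fun j => (i, j)))

/-- The cells of the staircase in reading order. -/
def staircaseCells (n : ℕ) : List (ℕ × ℕ) :=
  (squareCells n).filter (· ∈ allCells n)

lemma mem_allCells {n : ℕ} {c : ℕ × ℕ} :
    c ∈ allCells n ↔ 1 ≤ c.1 ∧ 1 ≤ c.2 ∧ c.1 + c.2 ≤ n := by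
  simp only [allCells, Finset.mem_filter, Finset.mem_product, Finset.mem_range]
  omega

lemma mem_squareCells {n : ℕ} {c : ℕ × ℕ} :
    c ∈ squareCells n ↔ (1 ≤ c.1 ∧ c.1 ≤ n) ∧ 1 ≤ c.2 ∧ c.2 ≤ n := by
  obtain ⟨i, j⟩ := c
  simp only [squareCells, List.mem_flatMap, List.mem_map, List.mem_reverse, List.mem_range,
    Prod.mk.injEq]
  constructor
  · rintro ⟨_, ⟨a, ha, rfl⟩, _, ⟨b, hb, rfl⟩, rfl, rfl⟩
    omega
  · rintro ⟨⟨h1, h2⟩, h3, h4⟩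
    exact ⟨i, ⟨i - 1, by omega, by omega⟩, j, ⟨j - 1, by omega, by omega⟩, rfl, rfl⟩

lemma nodup_squareCells (n : ℕ) : (squareCells n).Nodup := by
  have hr : ((List.range n).map (· + 1)).Nodup :=
    List.nodup_range.map (add_left_injective 1)
  rw [squareCells, List.nodup_flatMap]
  refine ⟨fun i _ => (List.nodup_reverse.mpr hr).map (Prod.mk_right_injective i), ?_⟩
  refine hr.imp ?_
  intro a b hab
  simp only [Function.onFun, List.disjoint_left, List.mem_map]
  rintro _ ⟨x, -, rfl⟩ ⟨y, -, h⟩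
  exact hab (Prod.mk.inj h).1.symm

lemma toFinset_staircaseCells (n : ℕ) : (staircaseCells n).toFinset = allCells n := by
  ext c
  simp only [staircaseCells, List.mem_toFinset, List.mem_filter, mem_squareCells,
    decide_eq_true_eq, mem_allCells]
  omega

lemma pdWord_eq_map_filter {n : ℕ} {D : Finset (ℕ × ℕ)} (hD : D ⊆ allCells n) :
    pdWord n D = ((staircaseCells n).filter (· ∈ D)).map (fun c => c.1 + c.2 - 1) := by
  have h : (staircaseCells n).filter (· ∈ D) = (squareCells n).filter (· ∈ D) := by
    rw [staircaseCells, List.filter_filter]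
    apply List.filter_congr
    intro c _
    by_cases hc : c ∈ D
    · simp [hc, hD hc]
    · simp [hc]
  rw [h, squareCells, pdWord, List.filter_flatMap, List.map_flatMap]
  simp only [List.filter_map, List.map_map]
  rfl

lemma foldr_descentStep_staircaseCells (n : ℕ) (w : Equiv.Perm (Fin n)) :
    ((staircaseCells n).map (fun c => c.1 + c.2 - 1)).foldr (descentStep n) w = 1 := by
  have h : (staircaseCells n).map (fun c => c.1 + c.2 - 1) =
      ((squareCells n).map (fun c => c.1 + c.2 - 1)).filter (fun k => 0 < k ∧ k < n) := by
    rw [List.filter_map, staircaseCells]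
    congr 1
    apply List.filter_congr
    intro c hc
    rw [mem_squareCells] at hc
    simp only [mem_allCells, Function.comp, decide_eq_decide]
    omega
  rw [h, foldr_descentStep_filter]
  convert foldr_descentStep_staircase n w using 2
  simp only [squareCells, List.map_flatMap, List.flatMap_map, List.map_map, List.map_reverse]
  congr 1
  funext i
  congr 1
  apply List.map_congr_left
  intro t _
  simp only [Function.comp]
  omega

lemma length_pdWord {n : ℕ} {D : Finset (ℕ × ℕ)} (hD : D ⊆ allCells n) :
    (pdWord n D).length = D.card := by
  rw [pdWord_eq_map_filter hD, List.length_map]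
  have hnd : ((staircaseCells n).filter (· ∈ D)).Nodup :=
    ((nodup_squareCells n).filter _).filter _
  rw [← List.toFinset_card_of_nodup hnd, List.toFinset_filter, toFinset_staircaseCells]
  congr 1
  ext c
  simpa using fun h => hD h

theorem sum_pipeDreams_pdDemazure (n : ℕ) (w : Equiv.Perm (Fin n)) :
    ∑ D ∈ (allCells n).powerset.filter (fun D => pdDemazure n (pdWord n D) = w),
      (-1 : ℤ) ^ D.card = (-1 : ℤ) ^ invCount n w := by
  have h := sum_subwords_pdDemazure n (fun c : ℕ × ℕ => c.1 + c.2 - 1) (staircaseCells n)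
    ((nodup_squareCells n).filter _) (fun c hc => by
      have : c ∈ allCells n := by rw [← toFinset_staircaseCells]; simpa using hc
      rw [mem_allCells] at this
      omega) w
  rw [toFinset_staircaseCells, foldr_descentStep_staircaseCells, if_pos rfl] at h
  rw [← h, Finset.sum_filter]
  refine Finset.sum_congr rfl fun D hD => ?_
  rw [pdWord_eq_map_filter (Finset.mem_powerset.mp hD)]

/-! ### Toggling the target of the topmost slide move -/

/-- The word of a single row of a pipe dream. -/
def rowWord (n : ℕ) (D : Finset (ℕ × ℕ)) (i : ℕ) : List ℕ :=
  (((List.range n).map (· + 1)).reverse.filter (fun j => (i, j) ∈ D)).map (fun j => i + j - 1)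

lemma pdWord_eq_flatMap_rowWord (n : ℕ) (D : Finset (ℕ × ℕ)) :
    pdWord n D = ((List.range n).map (· + 1)).flatMap (rowWord n D) := rfl

lemma range_map_succ_eq_append {n m : ℕ} (h1 : 1 ≤ m) (hm : m ≤ n) :
    (List.range n).map (· + 1) =
      List.range' 1 (m - 1) ++ m :: List.range' (m + 1) (n - m) := by
  have h : (List.range n).map (· + 1) = List.range' 1 n := by
    rw [List.range'_eq_map_range]
    exact List.map_congr_left fun x _ => Nat.add_comm x 1
  rw [h, ← List.range'_succ]
  conv_rhs => rw [show m = 1 + (m - 1) by omega]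
  rw [show 1 + (m - 1) - 1 = m - 1 by omega, List.range'_append_1]
  congr 1
  omega

lemma rowWord_congr {n i : ℕ} {D D' : Finset (ℕ × ℕ)} (h : ∀ j, (i, j) ∈ D ↔ (i, j) ∈ D') :
    rowWord n D i = rowWord n D' i := by
  simp only [rowWord, h]

/-- Splitting a row word at the position of a cross. -/
lemma rowWord_eq_append {n i j : ℕ} {D : Finset (ℕ × ℕ)} (h1 : 1 ≤ j) (hj : j ≤ n)
    (hD : (i, j) ∈ D) :
    rowWord n D i =
      ((List.range' (j + 1) (n - j)).reverse.filter (fun j => (i, j) ∈ D)).map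
        (fun j => i + j - 1) ++ (i + j - 1) ::
      ((List.range' 1 (j - 1)).reverse.filter (fun j => (i, j) ∈ D)).map
        (fun j => i + j - 1) := by
  rw [rowWord, range_map_succ_eq_append h1 hj]
  simp [List.filter_append, hD]

lemma rowWord_of_leftmost {n i j : ℕ} {D : Finset (ℕ × ℕ)} (h1 : 1 ≤ j) (hj : j ≤ n)
    (hD : (i, j) ∈ D) (hl : ∀ j', (i, j') ∈ D → j ≤ j') :
    ∃ X, rowWord n D i = X ++ [i + j - 1] := by
  have h : (List.range' 1 (j - 1)).reverse.filter (fun j => (i, j) ∈ D) = [] := by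
    rw [List.filter_eq_nil_iff]
    intro x hx hxD
    have := hl x (by simpa using hxD)
    rw [List.mem_reverse, List.mem_range'_1] at hx
    omega
  rw [rowWord_eq_append h1 hj hD, h]
  exact ⟨_, rfl⟩

lemma rowWord_insert_of_rightmost {n i j : ℕ} {D : Finset (ℕ × ℕ)} (h1 : 1 ≤ j) (hj : j ≤ n)
    (hD : (i, j) ∉ D) (hr : ∀ j', (i, j') ∈ D → j' ≤ j) :
    rowWord n (insert (i, j) D) i = (i + j - 1) :: rowWord n D i := by
  have hright : ∀ x ∈ (List.range' (j + 1) (n - j)).reverse, j < x := by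
    intro x hx
    rw [List.mem_reverse, List.mem_range'_1] at hx
    omega
  have h : (List.range' (j + 1) (n - j)).reverse.filter
      (fun x => (i, x) ∈ insert (i, j) D) = [] := by
    rw [List.filter_eq_nil_iff]
    intro x hx hxD
    have hlt := hright x hx
    rcases Finset.mem_insert.mp (of_decide_eq_true hxD) with e | e
    · have := (Prod.mk.inj e).2
      omega
    · have := hr x e
      omega
  have h' : (List.range' (j + 1) (n - j)).reverse.filter (fun x => (i, x) ∈ D) = [] := by
    rw [List.filter_eq_nil_iff]
    intro x hx hxD
    have := hright x hx
    have := hr x (of_decide_eq_true hxD)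
    omega
  have h'' : (List.range' 1 (j - 1)).reverse.filter (fun x => (i, x) ∈ insert (i, j) D) =
      (List.range' 1 (j - 1)).reverse.filter (fun x => (i, x) ∈ D) := by
    apply List.filter_congr
    intro x hx
    rw [List.mem_reverse, List.mem_range'_1] at hx
    have : x ≠ j := by omega
    simp [this]
  rw [rowWord_eq_append h1 hj (Finset.mem_insert_self _ _), h, h'', List.map_nil,
    List.nil_append, rowWord, range_map_succ_eq_append h1 hj, List.reverse_append,
    List.reverse_cons, List.filter_append, List.filter_append, h']
  simp [hD]

/-- Adding a cross at the target of an available slide move duplicates a letter. -/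
lemma pdDemazure_insert_slideTarget {n i j : ℕ} {D : Finset (ℕ × ℕ)} (hD : D ⊆ allCells n)
    (h : AdmitsSlideAt D i j) :
    pdDemazure n (pdWord n (insert (i + 1, j - 1) D)) = pdDemazure n (pdWord n D) := by
  obtain ⟨hij, hj2, hl, hr⟩ := h
  by_cases hc : (i + 1, j - 1) ∈ D
  · rw [Finset.insert_eq_of_mem hc]
  have hcell := mem_allCells.mp (hD hij)
  simp only at hcell
  have hrows : ∀ r, r ≠ i + 1 → rowWord n (insert (i + 1, j - 1) D) r = rowWord n D r :=
    fun r hri => rowWord_congr fun x => by simp [hri]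
  obtain ⟨X, hX⟩ := rowWord_of_leftmost (n := n) (by omega) (by omega) hij hl
  have hY := rowWord_insert_of_rightmost (n := n) (by omega) (by omega) hc
    (fun j' hj' => by have := hr j' hj'; omega)
  rw [show i + 1 + (j - 1) - 1 = i + j - 1 by omega] at hY
  have hsplit : (List.range n).map (· + 1) =
      List.range' 1 (i - 1) ++ i :: (i + 1) :: List.range' (i + 2) (n - i - 1) := by
    rw [range_map_succ_eq_append (m := i) (by omega) (by omega),
      show n - i = (n - i - 1) + 1 by omega, List.range'_succ]
    rfl
  have hA : (List.range' 1 (i - 1)).flatMap (rowWord n (insert (i + 1, j - 1) D)) =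
      (List.range' 1 (i - 1)).flatMap (rowWord n D) := by
    apply List.flatMap_congr
    intro r hr
    rw [List.mem_range'_1] at hr
    exact hrows r (by omega)
  have hB : (List.range' (i + 2) (n - i - 1)).flatMap (rowWord n (insert (i + 1, j - 1) D)) =
      (List.range' (i + 2) (n - i - 1)).flatMap (rowWord n D) := by
    apply List.flatMap_congr
    intro r hr
    rw [List.mem_range'_1] at hr
    exact hrows r (by omega)
  rw [pdWord_eq_flatMap_rowWord, pdWord_eq_flatMap_rowWord, hsplit]
  simp only [List.flatMap_append, List.flatMap_cons, hA, hB, hrows i (by omega), hX, hY]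
  have := pdDemazure_append_dup n ((List.range' 1 (i - 1)).flatMap (rowWord n D) ++ X)
    (rowWord n D (i + 1) ++ (List.range' (i + 2) (n - i - 1)).flatMap (rowWord n D))
    (i + j - 1)
  simpa using this

/-- `D` admits a slide move in row `p.1` at column `p.2`, and in no earlier row. -/
def TopmostSlideAt (D : Finset (ℕ × ℕ)) (p : ℕ × ℕ) : Prop :=
  AdmitsSlideAt D p.1 p.2 ∧ ∀ i < p.1, ∀ j, ¬ AdmitsSlideAt D i j

lemma exists_topmostSlideAt {D : Finset (ℕ × ℕ)} (h : ¬ QuasiYamanouchi D) :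
    ∃ p, TopmostSlideAt D p := by
  have h' : ∃ i, ∃ j, AdmitsSlideAt D i j := by
    simpa [QuasiYamanouchi] using h
  obtain ⟨j, hj⟩ := Nat.find_spec h'
  exact ⟨(Nat.find h', j), hj, fun i hi j hij => Nat.find_min h' hi ⟨j, hij⟩⟩

lemma TopmostSlideAt.unique {D : Finset (ℕ × ℕ)} {p q : ℕ × ℕ} (hp : TopmostSlideAt D p)
    (hq : TopmostSlideAt D q) : p = q := by
  have h1 : p.1 = q.1 := by
    rcases lt_trichotomy p.1 q.1 with h | h | h
    · exact absurd hp.1 (hq.2 _ h _)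
    · exact h
    · exact absurd hq.1 (hp.2 _ h _)
  refine Prod.ext h1 (le_antisymm (hp.1.2.2.1 _ ?_) (hq.1.2.2.1 _ ?_))
  · rw [h1]; exact hq.1.1
  · rw [← h1]; exact hp.1.1

/-- The target of the slide move at `p`. -/
def slideTarget (p : ℕ × ℕ) : ℕ × ℕ := (p.1 + 1, p.2 - 1)

/-- Toggling the membership of `c` in `D`. -/
def toggle (D : Finset (ℕ × ℕ)) (c : ℕ × ℕ) : Finset (ℕ × ℕ) :=
  if c ∈ D then D.erase c else insert c D

lemma mem_toggle_of_ne {D : Finset (ℕ × ℕ)} {c d : ℕ × ℕ} (h : d ≠ c) :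
    d ∈ toggle D c ↔ d ∈ D := by
  unfold toggle
  split_ifs <;> simp [h]

lemma toggle_toggle (D : Finset (ℕ × ℕ)) (c : ℕ × ℕ) : toggle (toggle D c) c = D := by
  by_cases h : c ∈ D
  · simp [toggle, h]
  · simp [toggle, h]

lemma toggle_ne (D : Finset (ℕ × ℕ)) (c : ℕ × ℕ) : toggle D c ≠ D := by
  unfold toggle
  split_ifs with h
  · exact fun e => Finset.notMem_erase c D (e.symm ▸ h)
  · exact fun e => h (e ▸ Finset.mem_insert_self c D)

lemma neg_one_pow_card_toggle (D : Finset (ℕ × ℕ)) (c : ℕ × ℕ) :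
    (-1 : ℤ) ^ D.card + (-1 : ℤ) ^ (toggle D c).card = 0 := by
  unfold toggle
  split_ifs with h
  · rw [← Finset.card_erase_add_one h, pow_succ]; ring
  · rw [Finset.card_insert_of_notMem h, pow_succ]; ring

lemma AdmitsSlideAt.toggle_slideTarget {D : Finset (ℕ × ℕ)} {p : ℕ × ℕ}
    (h : AdmitsSlideAt D p.1 p.2) :
    AdmitsSlideAt (toggle D (slideTarget p)) p.1 p.2 := by
  obtain ⟨h1, h2, h3, h4⟩ := h
  have hne : ∀ x, (p.1, x) ≠ slideTarget p := fun x e =>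
    absurd (congrArg Prod.fst e) (by simp [slideTarget])
  refine ⟨(mem_toggle_of_ne (hne _)).mpr h1, h2, fun j' hj' =>
    h3 j' ((mem_toggle_of_ne (hne _)).mp hj'), fun j' hj' => ?_⟩
  by_cases e : j' = p.2 - 1
  · omega
  · exact h4 j' ((mem_toggle_of_ne (by simp [slideTarget, e])).mp hj')

lemma TopmostSlideAt.toggle_slideTarget {D : Finset (ℕ × ℕ)} {p : ℕ × ℕ}
    (h : TopmostSlideAt D p) : TopmostSlideAt (toggle D (slideTarget p)) p := by
  refine ⟨h.1.toggle_slideTarget, fun i hi j hij => h.2 i hi j ?_⟩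
  have hmem : ∀ r ≤ p.1, ∀ x, (r, x) ∈ toggle D (slideTarget p) ↔ (r, x) ∈ D :=
    fun r hr x => mem_toggle_of_ne fun e => by
      have := (Prod.mk.inj e).1
      omega
  simpa only [AdmitsSlideAt, hmem i hi.le, hmem (i + 1) hi] using hij

lemma toggle_slideTarget_subset {n : ℕ} {D : Finset (ℕ × ℕ)} {p : ℕ × ℕ}
    (hD : D ⊆ allCells n) (h : AdmitsSlideAt D p.1 p.2) :
    toggle D (slideTarget p) ⊆ allCells n := by
  unfold toggle
  split_ifs
  · exact (Finset.erase_subset _ _).trans hD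
  · refine Finset.insert_subset (mem_allCells.mpr ?_) hD
    have := mem_allCells.mp (hD h.1)
    have := h.2.1
    simp only [slideTarget] at *
    omega

lemma pdDemazure_toggle_slideTarget {n : ℕ} {D : Finset (ℕ × ℕ)} {p : ℕ × ℕ}
    (hD : D ⊆ allCells n) (h : AdmitsSlideAt D p.1 p.2) :
    pdDemazure n (pdWord n (toggle D (slideTarget p))) = pdDemazure n (pdWord n D) := by
  by_cases hc : slideTarget p ∈ D
  · have h' := pdDemazure_insert_slideTarget (toggle_slideTarget_subset hD h)
      h.toggle_slideTarget
    rw [← h']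
    congr 2
    simp only [toggle, if_pos hc]
    exact Finset.insert_erase hc
  · simp only [toggle, if_neg hc]
    exact pdDemazure_insert_slideTarget hD h

/-- The pipe dreams that are not quasi-Yamanouchi cancel. -/
theorem sum_not_quasiYamanouchi (n : ℕ) (w : Equiv.Perm (Fin n)) :
    ∑ D ∈ (allCells n).powerset.filter
        (fun D => ¬ QuasiYamanouchi D ∧ pdDemazure n (pdWord n D) = w),
      (-1 : ℤ) ^ D.card = 0 := by
  have hmem : ∀ D, D ∈ (allCells n).powerset.filter
      (fun D => ¬ QuasiYamanouchi D ∧ pdDemazure n (pdWord n D) = w) ↔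
      D ⊆ allCells n ∧ ¬ QuasiYamanouchi D ∧ pdDemazure n (pdWord n D) = w := by
    intro D
    rw [Finset.mem_filter, Finset.mem_powerset]
  have hex : ∀ D ∈ (allCells n).powerset.filter
      (fun D => ¬ QuasiYamanouchi D ∧ pdDemazure n (pdWord n D) = w),
      ∃ p, TopmostSlideAt D p :=
    fun D hD => exists_topmostSlideAt ((hmem D).mp hD).2.1
  choose p hp using hex
  have htoggle : ∀ D hD, toggle D (slideTarget (p D hD)) ∈ (allCells n).powerset.filter
      (fun D => ¬ QuasiYamanouchi D ∧ pdDemazure n (pdWord n D) = w) := by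
    intro D hD
    have hDc := ((hmem D).mp hD).1
    refine (hmem _).mpr ⟨toggle_slideTarget_subset hDc (hp D hD).1,
      fun hq => hq _ _ (hp D hD).1.toggle_slideTarget, ?_⟩
    rw [pdDemazure_toggle_slideTarget hDc (hp D hD).1]
    exact ((hmem D).mp hD).2.2
  refine Finset.sum_involution (fun D hD => toggle D (slideTarget (p D hD)))
    (fun D hD => neg_one_pow_card_toggle D _) (fun D hD _ => toggle_ne D _) htoggle ?_
  intro D hD
  have h : p _ (htoggle D hD) = p D hD :=
    (hp _ (htoggle D hD)).unique (hp D hD).toggle_slideTarget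
  simp only [h, toggle_toggle]

/-- For every `n ≥ 2` and every permutation `w ∈ S_n`, the sum over all quasi-Yamanouchi
pipe dreams `D` of size `n` with shape `w` of `(−1)^(|D| − ℓ(w))` equals `1`;
equivalently `Σ_k (−1)^k |QPD_k(w)| = 1`. -/
theorem quasiYamanouchi_alternating_sum (n : ℕ) (hn : 2 ≤ n) (w : Equiv.Perm (Fin n)) :
    ∑ D ∈ (allCells n).powerset.filter
        (fun D => QuasiYamanouchi D ∧ pdDemazure n (pdWord n D) = w),
      (-1 : ℤ) ^ (D.card - invCount n w) = 1 := by
  have hall := sum_pipeDreams_pdDemazure n w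
  rw [← Finset.sum_filter_add_sum_filter_not _ QuasiYamanouchi, Finset.filter_filter,
    Finset.filter_filter] at hall
  have hnot := sum_not_quasiYamanouchi n w
  simp only [and_comm (b := pdDemazure n _ = w)] at hnot ⊢
  rw [hnot, add_zero] at hall
  have hsign : ∀ D ∈ (allCells n).powerset.filter
      (fun D => pdDemazure n (pdWord n D) = w ∧ QuasiYamanouchi D),
      (-1 : ℤ) ^ (D.card - invCount n w) = (-1 : ℤ) ^ D.card * (-1 : ℤ) ^ invCount n w := by
    intro D hD
    obtain ⟨hDc, hDw, -⟩ := Finset.mem_filter.mp hD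
    have hle : invCount n w ≤ D.card := by
      rw [← hDw, ← length_pdWord (Finset.mem_powerset.mp hDc)]
      exact invCount_pdDemazure_le_length n _
    obtain ⟨e, he⟩ := Nat.exists_eq_add_of_le hle
    rw [he, Nat.add_sub_cancel_left, pow_add, mul_right_comm, ← mul_pow]
    simp
  rw [Finset.sum_congr rfl hsign, ← Finset.sum_mul, hall, ← mul_pow]
  simp
end
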